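/- arXiv:2604.17078 — 4 statements merged into one kernel-verified Lean document; each statement's English description precedes it below -/
import Mathlib

section
/- Let P ∈ ℝ^{d×d} be a symmetric positive semi-definite matrix. Then ‖P − I_d‖_F ≤ ‖P² − I_d‖_F, where ‖·‖_F denotes the Frobenius norm and I_d the d×d identity matrix. -/
open Matrix

/-- The Frobenius norm of a real matrix: `√(∑ i, ∑ j, (M i j)^2)`. -/
noncomputable def frobNorm {m n : Type*} [Fintype m] [Fintype n] (M : Matrix m n ℝ) : ℝ :=
  Real.sqrt (∑ i, ∑ j, (M i j) ^ 2)

lemma frob_sum_eq_trace {d : ℕ} (X : Matrix (Fin d) (Fin d) ℝ) :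
    ∑ i, ∑ j, (X i j) ^ 2 = (Xᴴ * X).trace := by
  rw [Finset.sum_comm]
  simp [Matrix.trace, Matrix.mul_apply, sq]

/-- For a symmetric positive semi-definite matrix `P`,
`‖P − I‖_F ≤ ‖P² − I‖_F`. -/
theorem frobNorm_sub_one_le_frobNorm_sq_sub_one
    {d : ℕ} (P : Matrix (Fin d) (Fin d) ℝ) (hP : P.PosSemidef) :
    frobNorm (P - 1) ≤ frobNorm (P ^ 2 - 1) := by
  unfold frobNorm
  apply Real.sqrt_le_sqrt
  rw [frob_sum_eq_trace, frob_sum_eq_trace]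
  have hH : Pᴴ = P := hP.isHermitian
  have h1 := (hP.conjTranspose_mul_mul_same (P - 1)).trace_nonneg
  have h2 := ((hP.pow 2).conjTranspose_mul_mul_same (P - 1)).trace_nonneg
  have key : (P ^ 2 - 1)ᴴ * (P ^ 2 - 1) = (P - 1)ᴴ * (P - 1)
      + ((P - 1)ᴴ * P * (P - 1) + (P - 1)ᴴ * P * (P - 1))
      + (P - 1)ᴴ * P ^ 2 * (P - 1) := by
    simp only [conjTranspose_sub, conjTranspose_pow, conjTranspose_one, hH]
    noncomm_ring
  rw [key, trace_add, trace_add, trace_add]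
  linarith
end

section
/- Let W ∈ ℝ^{m×d} with m ≥ d. Then there exist a matrix Q ∈ ℝ^{m×d} with orthonormal columns (Qᵀ Q = I_d) and a symmetric positive semi-definite matrix P ∈ ℝ^{d×d} such that W = Q P and ‖P − I_d‖_F ≤ ‖Wᵀ W − I_d‖_F. -/
open Matrix

lemma frob_conj {d : ℕ} (U : Matrix (Fin d) (Fin d) ℝ) (hU : Uᵀ * U = 1) (f : Fin d → ℝ) :
    frobNorm (U * diagonal f * Uᵀ) = Real.sqrt (∑ i, f i ^ 2) := by
  have h1 : ∀ M : Matrix (Fin d) (Fin d) ℝ, ∑ i, ∑ j, (M i j) ^ 2 = (M * Mᵀ).trace := by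
    intro M
    simp [Matrix.trace, Matrix.mul_apply, pow_two]
  unfold frobNorm
  rw [h1]
  congr 1
  have h2 : (U * diagonal f * Uᵀ) * (U * diagonal f * Uᵀ)ᵀ
      = U * (diagonal f * diagonal f * Uᵀ) := by
    simp only [transpose_mul, transpose_transpose, diagonal_transpose]
    calc _ = U * diagonal f * (Uᵀ * U) * (diagonal f * Uᵀ) := by simp only [Matrix.mul_assoc]
      _ = _ := by rw [hU]; simp only [Matrix.mul_assoc, Matrix.one_mul]
  rw [h2, Matrix.trace_mul_comm, Matrix.mul_assoc, hU, Matrix.mul_one, diagonal_mul_diagonal,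
    trace_diagonal]
  simp [pow_two]

lemma exists_left {m d : ℕ} (hmd : d ≤ m) (A : Matrix (Fin m) (Fin d) ℝ) (s : Fin d → ℝ)
    (hA : Aᵀ * A = diagonal (fun i => s i ^ 2)) :
    ∃ V : Matrix (Fin m) (Fin d) ℝ, Vᵀ * V = 1 ∧ V * diagonal s = A := by
  have hA' : ∀ i j, ∑ k, A k i * A k j = if i = j then s i ^ 2 else 0 := by
    intro i j
    have := congrFun (congrFun hA i) j
    simpa [Matrix.mul_apply, diagonal_apply] using this
  let v : Fin m → EuclideanSpace ℝ (Fin m) := fun k =>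
    if h : (k : ℕ) < d then WithLp.toLp 2 (fun l => (s ⟨k, h⟩)⁻¹ * A l ⟨k, h⟩) else 0
  let S : Set (Fin m) := {k | ∃ h : (k : ℕ) < d, s ⟨k, h⟩ ≠ 0}
  have hv : Orthonormal ℝ (S.domRestrict v) := by
    rw [orthonormal_iff_ite]
    rintro ⟨k, hk, hks⟩ ⟨l, hl, hls⟩
    have : inner ℝ (v k) (v l)
        = (s ⟨k, hk⟩)⁻¹ * (s ⟨l, hl⟩)⁻¹ * ∑ i, A i ⟨k, hk⟩ * A i ⟨l, hl⟩ := by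
      simp only [v, hk, hl, dif_pos, PiLp.inner_apply, Finset.mul_sum]
      refine Finset.sum_congr rfl fun i _ => ?_
      simp
      ring
    rw [hA'] at this
    simp only [Set.domRestrict_apply, this, Subtype.mk.injEq, Fin.mk.injEq, Fin.ext_iff]
    by_cases h : (k : ℕ) = l
    · have h' : k = l := Fin.ext h
      subst h'
      simp
      field_simp
    · simp [h]
  obtain ⟨b, hb⟩ := hv.exists_orthonormalBasis_extension_of_card_eq (by simp)
  refine ⟨Matrix.of fun i j => b (Fin.castLE hmd j) i, ?_, ?_⟩
  · ext i j
    have := orthonormal_iff_ite.mp b.orthonormal (Fin.castLE hmd i) (Fin.castLE hmd j)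
    simp only [PiLp.inner_apply, (Fin.castLE_injective hmd).eq_iff] at this
    rw [Matrix.one_apply, ← this, Matrix.mul_apply]
    refine Finset.sum_congr rfl fun k _ => ?_
    simp [mul_comm]
  · ext i j
    rw [Matrix.mul_diagonal]
    by_cases h : s j = 0
    · have h0 := hA' j j
      simp only [if_true, h] at h0
      have := (Finset.sum_eq_zero_iff_of_nonneg (fun k _ => mul_self_nonneg (A k j))).mp
        (h0.trans (by norm_num)) i (Finset.mem_univ _)
      rw [h, mul_zero, mul_self_eq_zero.mp this]
    · have := hb (Fin.castLE hmd j) ⟨j.2, h⟩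
      simp only [Matrix.of_apply, this]
      simp [v]
      field_simp

/-- Polar decomposition with a norm bound: every `W ∈ ℝ^{m×d}` with `m ≥ d`
factors as `W = Q P` with `Qᵀ Q = I`, `P` symmetric positive semi-definite, and
`‖P − I‖_F ≤ ‖Wᵀ W − I‖_F`. -/
theorem exists_polar_decomposition_frobNorm_bound
    {m d : ℕ} (hmd : d ≤ m) (W : Matrix (Fin m) (Fin d) ℝ) :
    ∃ (Q : Matrix (Fin m) (Fin d) ℝ) (P : Matrix (Fin d) (Fin d) ℝ),
      Qᵀ * Q = 1 ∧ P.PosSemidef ∧ W = Q * P ∧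
      frobNorm (P - 1) ≤ frobNorm (Wᵀ * W - 1) := by
  have hps : (Wᵀ * W).PosSemidef := by
    simpa [conjTranspose_eq_transpose_of_trivial] using posSemidef_conjTranspose_mul_self W
  obtain ⟨U, s, hU, hU', hs, hW⟩ : ∃ (U : Matrix (Fin d) (Fin d) ℝ) (s : Fin d → ℝ),
      Uᵀ * U = 1 ∧ U * Uᵀ = 1 ∧ (∀ i, 0 ≤ s i) ∧
      Wᵀ * W = U * diagonal (fun i => s i ^ 2) * Uᵀ := by
    refine ⟨hps.1.eigenvectorUnitary, fun i => Real.sqrt (hps.1.eigenvalues i), ?_, ?_,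
      fun i => Real.sqrt_nonneg _, ?_⟩
    · have := Unitary.coe_star_mul_self hps.1.eigenvectorUnitary
      simpa [star_eq_conjTranspose, conjTranspose_eq_transpose_of_trivial] using this
    · have := Unitary.coe_mul_star_self hps.1.eigenvectorUnitary
      simpa [star_eq_conjTranspose, conjTranspose_eq_transpose_of_trivial] using this
    · have := hps.1.spectral_theorem
      simp only [Real.sq_sqrt (hps.eigenvalues_nonneg _)]
      rw [Unitary.conjStarAlgAut_apply] at this
      simpa [star_eq_conjTranspose, conjTranspose_eq_transpose_of_trivial,
        Function.comp_def] using this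
  obtain ⟨V, hV, hVA⟩ := exists_left hmd (W * U) s (by
    calc (W * U)ᵀ * (W * U) = Uᵀ * (Wᵀ * W) * U := by
          simp only [transpose_mul, Matrix.mul_assoc]
      _ = (Uᵀ * U) * diagonal (fun i => s i ^ 2) * (Uᵀ * U) := by
          rw [hW]; simp only [Matrix.mul_assoc]
      _ = _ := by rw [hU, Matrix.one_mul, Matrix.mul_one])
  have hsub : ∀ f : Fin d → ℝ, U * diagonal f * Uᵀ - 1 = U * diagonal (fun i => f i - 1) * Uᵀ := by
    intro f
    have : diagonal (fun i => f i - 1) = diagonal f - (1 : Matrix (Fin d) (Fin d) ℝ) := by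
      rw [← diagonal_one, diagonal_sub]
    rw [this, Matrix.mul_sub, Matrix.sub_mul, Matrix.mul_one, hU']
  refine ⟨V * Uᵀ, U * diagonal s * Uᵀ, ?_, ?_, ?_, ?_⟩
  · calc (V * Uᵀ)ᵀ * (V * Uᵀ) = U * (Vᵀ * V) * Uᵀ := by
          simp only [transpose_mul, transpose_transpose, Matrix.mul_assoc]
      _ = 1 := by rw [hV, Matrix.mul_one, hU']
  · have := (PosSemidef.diagonal (n := Fin d) (d := s) hs).mul_mul_conjTranspose_same U
    simpa [conjTranspose_eq_transpose_of_trivial] using this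
  · symm
    calc V * Uᵀ * (U * diagonal s * Uᵀ) = V * (Uᵀ * U) * diagonal s * Uᵀ := by
          simp only [Matrix.mul_assoc]
      _ = W * (U * Uᵀ) := by rw [hU, Matrix.mul_one, hVA, Matrix.mul_assoc]
      _ = W := by rw [hU', Matrix.mul_one]
  · rw [hW, hsub, hsub, frob_conj U hU, frob_conj U hU]
    apply Real.sqrt_le_sqrt
    refine Finset.sum_le_sum fun i _ => ?_
    have h := hs i
    have : (s i ^ 2 - 1) ^ 2 = (s i - 1) ^ 2 * (s i + 1) ^ 2 := by ring
    rw [this]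
    exact le_mul_of_one_le_right (sq_nonneg _) (by nlinarith)
end

section
/- Let (Ω, ℱ, 𝒫) be a probability space and A, B, C measurable events. Suppose: 𝒫(A) > 0, 0 < 𝒫(C) < 1, 𝒫(Aᶜ) > 0, 𝒫(Aᶜ ∩ C) > 0; 𝒫(B | A ∩ C) = 1 and 𝒫(B | A) = 1 (the event A implies B and C up to null sets, in particular 𝒫(C | A) = 1); and setting q = 𝒫(B | Aᶜ), the conditional-independence condition 𝒫(B | Aᶜ ∩ C) = q holds with q < 1. Then 𝒫(B | C) > 𝒫(B). -/
open MeasureTheory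

/-- Bayesian analysis of TFS (A), WD (B) and WVO (C). If `A` has
positive probability, `0 < 𝒫(C) < 1`, `𝒫(Aᶜ) > 0`, `𝒫(Aᶜ ∩ C) > 0`,
`𝒫(B | A ∩ C) = 1`, `𝒫(B | A) = 1`, `𝒫(C | A) = 1`, and, with `q = 𝒫(B | Aᶜ)`,
the conditional-independence condition `𝒫(B | Aᶜ ∩ C) = q` holds with `q < 1`,
then `𝒫(B | C) > 𝒫(B)`. -/
theorem cond_prob_B_given_C_gt_prob_B
    {Ω : Type*} [MeasurableSpace Ω] (μ : Measure Ω) [IsProbabilityMeasure μ]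
    (A B C : Set Ω)
    (hAm : MeasurableSet A) (hBm : MeasurableSet B) (hCm : MeasurableSet C)
    (hApos : 0 < μ A) (hCpos : 0 < μ C) (hClt : μ C < 1)
    (hAcpos : 0 < μ Aᶜ) (hAcCpos : 0 < μ (Aᶜ ∩ C))
    (hBAC : μ (B ∩ (A ∩ C)) / μ (A ∩ C) = 1)
    (hBA : μ (B ∩ A) / μ A = 1)
    (hCA : μ (C ∩ A) / μ A = 1)
    (q : ENNReal) (hq : μ (B ∩ Aᶜ) / μ Aᶜ = q)
    (hcondindep : μ (B ∩ (Aᶜ ∩ C)) / μ (Aᶜ ∩ C) = q)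
    (hqlt : q < 1) :
    μ (B ∩ C) / μ C > μ B := by
  have pos : ∀ S : Set Ω, 0 < μ S → 0 < μ.real S := fun S h =>
    ENNReal.toReal_pos h.ne' (measure_ne_top μ S)
  have key : ∀ (S T : Set Ω) (r : ENNReal), 0 < μ T → μ S / μ T = r →
      μ.real S = r.toReal * μ.real T := by
    intro S T r hT h
    have h1 := congrArg ENNReal.toReal h
    rw [ENNReal.toReal_div] at h1
    exact (div_eq_iff (pos T hT).ne').mp h1
  have split : ∀ S : Set Ω, μ.real (S ∩ A) + μ.real (S ∩ Aᶜ) = μ.real S := by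
    intro S
    have h := measureReal_inter_add_sdiff (μ := μ) (s := S) hAm
    rwa [Set.sdiff_eq] at h
  have e2 := key _ _ _ hApos hBA
  have e3 := key _ _ _ hApos hCA
  have e4 := key _ _ _ hAcpos hq
  have e5 := key _ _ _ hAcCpos hcondindep
  have hACpos : 0 < μ (A ∩ C) := by
    rw [Set.inter_comm, pos_iff_ne_zero]
    intro h0
    rw [h0] at hCA
    simp at hCA
  have e1 := key _ _ _ hACpos hBAC
  have sB := split B
  have sC := split C
  have sBC := split (B ∩ C)
  have sU := split Set.univ
  simp only [Set.univ_inter, probReal_univ] at sU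
  rw [Set.inter_assoc, Set.inter_assoc, Set.inter_comm C A, Set.inter_comm C Aᶜ] at sBC
  rw [Set.inter_comm C A, Set.inter_comm C Aᶜ] at sC
  rw [Set.inter_comm C A] at e3
  simp only [ENNReal.toReal_one, one_mul] at e1 e2 e3
  have hr : q.toReal < 1 := by
    have := (ENNReal.toReal_lt_toReal hqlt.ne_top ENNReal.one_ne_top).mpr hqlt
    simpa using this
  have hc : μ.real C < 1 := by
    have := (ENNReal.toReal_lt_toReal hClt.ne_top ENNReal.one_ne_top).mpr hClt
    simpa [Measure.real] using this
  have ha := pos A hApos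
  have fin : μ.real B * μ.real C < μ.real (B ∩ C) := by
    have h := mul_pos (mul_pos (sub_pos.mpr hr) ha) (sub_pos.mpr hc)
    have hB : μ.real B = μ.real A + q.toReal * (1 - μ.real A) := by
      rw [← sB, e2, e4, ← sU]; ring
    have hBC : μ.real (B ∩ C) = μ.real A + q.toReal * (μ.real C - μ.real A) := by
      rw [← sBC, e1, e3, e5, ← sC, e3]; ring
    rw [hB, hBC]
    nlinarith
  change μ B < μ (B ∩ C) / μ C
  rw [ENNReal.lt_div_iff_mul_lt (Or.inl hCpos.ne') (Or.inl (measure_ne_top μ C))]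
  rw [← ENNReal.toReal_lt_toReal (ENNReal.mul_ne_top (measure_ne_top μ B) (measure_ne_top μ C))
    (measure_ne_top μ _), ENNReal.toReal_mul]
  exact fin
end

section
/- Let E be a real inner product space, μ ∈ E nonzero, and u ∈ E with ‖u − μ‖ < ‖μ‖ (in particular u ≠ 0). Then sin(∠(u, μ)) ≤ ‖u − μ‖ / (‖μ‖ − ‖u − μ‖), where ∠(u, μ) ∈ [0, π] is the angle between u and μ defined by cos(∠(u, μ)) = ⟪u, μ⟫/(‖u‖·‖μ‖). -/
open InnerProductGeometry

/-- Directional alignment bound: if `μ ≠ 0` and `‖u − μ‖ < ‖μ‖`,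
then `sin(∠(u, μ)) ≤ ‖u − μ‖ / (‖μ‖ − ‖u − μ‖)`. -/
theorem sin_angle_le_ratio
    {E : Type*} [NormedAddCommGroup E] [InnerProductSpace ℝ E]
    (μ u : E) (hμ : μ ≠ 0) (h : ‖u - μ‖ < ‖μ‖) :
    Real.sin (angle u μ) ≤ ‖u - μ‖ / (‖μ‖ - ‖u - μ‖) := by
  have hpos : 0 < ‖μ‖ - ‖u - μ‖ := sub_pos.mpr h
  rw [le_div_iff₀ hpos]
  have hrev : ‖μ‖ - ‖u - μ‖ ≤ ‖u‖ := by
    have h1 := norm_sub_norm_le μ u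
    rw [norm_sub_rev] at h1
    linarith
  calc Real.sin (angle u μ) * (‖μ‖ - ‖u - μ‖)
      ≤ Real.sin (angle u μ) * ‖u‖ :=
        mul_le_mul_of_nonneg_left hrev (sin_angle_nonneg u μ)
    _ = Real.sin (angle μ (u - μ)) * ‖u - μ‖ :=
        sin_angle_mul_norm_eq_sin_angle_mul_norm u μ
    _ ≤ 1 * ‖u - μ‖ :=
        mul_le_mul_of_nonneg_right (Real.sin_le_one _) (norm_nonneg _)
    _ = ‖u - μ‖ := one_mul _
end
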